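/- Let V be a finite-dimensional real inner product space, U ⊆ V open, and let b : U → V be smooth with ‖b(x)‖ = 1 and Db(x)(u) = k(x)·(u − ⟨b(x),u⟩·b(x)) for a smooth k : U → ℝ (the flat Landsberg condition). Fix g ∈ ℝ with |g| < 2, set h = √(1 − g²/4), and define q, v, A, B, Λ and the spray endomorphism G_{x,y} as in the flat Finsleroid setting. Then for all x ∈ U, all y₁, y₂ with q(x,y₁) > 0 and q(x,y₂) > 0 such that −1 < Λ(x,y₁,y₂) < 1, the angle α(x,y₁,y₂) = (1/h)·arccos Λ(x,y₁,y₂) satisfies, for all w ∈ V: D_xα(x,y₁,y₂)(w) = (1/2)·D_{y₁}α(x,y₁,y₂)(G_{x,y₁}(w)) + (1/2)·D_{y₂}α(x,y₁,y₂)(G_{x,y₂}(w)). -/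

import Mathlib

open scoped InnerProductSpace

lemma finsl_q {E : Type*} [NormedAddCommGroup E] [NormedSpace ℝ E]
    (β n : E → ℝ) (β' n' : E →L[ℝ] ℝ) (e : E)
    (hβ : HasFDerivAt β β' e) (hn : HasFDerivAt n n' e)
    (hpos : 0 < Real.sqrt (n e - β e ^ 2)) :
    HasFDerivAt (fun z => Real.sqrt (n z - β z ^ 2))
      ((1 / (2 * Real.sqrt (n e - β e ^ 2))) • (n' - (2 * β e) • β')) e := by
  have hp : n e - β e ^ 2 ≠ 0 := (Real.sqrt_pos.mp hpos).ne'
  have h1 : HasFDerivAt (fun z => n z - β z ^ 2) (n' - (2 * β e) • β') e := by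
    have := hn.sub (hβ.pow 2)
    refine this.congr_fderiv ?_
    ext w; simp
  exact h1.sqrt hp

lemma finsl_key {E : Type*} [NormedAddCommGroup E] [NormedSpace ℝ E]
    (g h : ℝ) (β₁ β₂ q₁ q₂ s : E → ℝ) (β₁' β₂' q₁' q₂' s' : E →L[ℝ] ℝ) (e : E)
    (hβ₁ : HasFDerivAt β₁ β₁' e) (hβ₂ : HasFDerivAt β₂ β₂' e)
    (hq₁ : HasFDerivAt q₁ q₁' e) (hq₂ : HasFDerivAt q₂ q₂' e)
    (hs : HasFDerivAt s s' e)
    (b1 b2 r1 r2 s0 B1 B2 N L : ℝ) (eb1 : β₁ e = b1) (eb2 : β₂ e = b2) (er1 : q₁ e = r1)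
    (er2 : q₂ e = r2) (es : s e = s0)
    (hB1 : B1 = b1 ^ 2 + g * b1 * r1 + r1 ^ 2)
    (hB2 : B2 = b2 ^ 2 + g * b2 * r2 + r2 ^ 2)
    (p1 : 0 < B1) (p2 : 0 < B2)
    (hN : N = (b1 + g / 2 * r1) * (b2 + g / 2 * r2) + h ^ 2 * (s0 - b1 * b2))
    (hL : L = N / Real.sqrt (B1 * B2)) (l1 : -1 < L) (l2 : L < 1) (w : E) :
    fderiv ℝ (fun z => (1 / h) * Real.arccos
      (((β₁ z + g / 2 * q₁ z) * (β₂ z + g / 2 * q₂ z) + h ^ 2 * (s z - β₁ z * β₂ z))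
        / Real.sqrt ((β₁ z ^ 2 + g * β₁ z * q₁ z + q₁ z ^ 2)
            * (β₂ z ^ 2 + g * β₂ z * q₂ z + q₂ z ^ 2)))) e w
      = (1 / h) * (-(1 / Real.sqrt (1 - L ^ 2))) * (1 / Real.sqrt (B1 * B2)) *
        (((β₁' w + g / 2 * q₁' w) * (b2 + g / 2 * r2)
          + (b1 + g / 2 * r1) * (β₂' w + g / 2 * q₂' w)
          + h ^ 2 * (s' w - β₁' w * b2 - b1 * β₂' w))
        - N / 2 * ((2 * b1 * β₁' w + g * (β₁' w * r1 + b1 * q₁' w) + 2 * r1 * q₁' w) / B1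
          + (2 * b2 * β₂' w + g * (β₂' w * r2 + b2 * q₂' w) + 2 * r2 * q₂' w) / B2)) := by
  have line : HasDerivAt (fun t : ℝ => e + t • w) w 0 := by
    simpa using ((hasDerivAt_id (0 : ℝ)).smul_const w).const_add e
  have e0 : e + (0 : ℝ) • w = e := by simp
  have cmp : ∀ (f : E → ℝ) (f' : E →L[ℝ] ℝ), HasFDerivAt f f' e →
      HasDerivAt (fun t : ℝ => f (e + t • w)) (f' w) 0 := by
    intro f f' hf
    have hf' : HasFDerivAt f f' (e + (0 : ℝ) • w) := by rw [e0]; exact hf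
    exact hf'.comp_hasDerivAt 0 line
  have hBB : (0 : ℝ) < B1 * B2 := mul_pos p1 p2
  have v1 : (β₁ e ^ 2 + g * β₁ e * q₁ e + q₁ e ^ 2) = B1 := by rw [eb1, er1, hB1]
  have v2 : (β₂ e ^ 2 + g * β₂ e * q₂ e + q₂ e ^ 2) = B2 := by rw [eb2, er2, hB2]
  have vN : ((β₁ e + g / 2 * q₁ e) * (β₂ e + g / 2 * q₂ e) + h ^ 2 * (s e - β₁ e * β₂ e)) = N := by
    rw [eb1, eb2, er1, er2, es, hN]
  have sB : Real.sqrt (B1 * B2) ≠ 0 := (Real.sqrt_pos.mpr hBB).ne'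
  have d1 := hβ₁.differentiableAt
  have d2 := hβ₂.differentiableAt
  have d3 := hq₁.differentiableAt
  have d4 := hq₂.differentiableAt
  have d5 := hs.differentiableAt
  have dN : DifferentiableAt ℝ (fun z => (β₁ z + g / 2 * q₁ z) * (β₂ z + g / 2 * q₂ z)
      + h ^ 2 * (s z - β₁ z * β₂ z)) e := by fun_prop
  have dB : DifferentiableAt ℝ (fun z => (β₁ z ^ 2 + g * β₁ z * q₁ z + q₁ z ^ 2)
            * (β₂ z ^ 2 + g * β₂ z * q₂ z + q₂ z ^ 2)) e := by fun_prop
  have dS := dB.sqrt (by rw [v1, v2]; exact hBB.ne')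
  have dQ : DifferentiableAt ℝ (fun z =>
      ((β₁ z + g / 2 * q₁ z) * (β₂ z + g / 2 * q₂ z) + h ^ 2 * (s z - β₁ z * β₂ z))
        / Real.sqrt ((β₁ z ^ 2 + g * β₁ z * q₁ z + q₁ z ^ 2)
            * (β₂ z ^ 2 + g * β₂ z * q₂ z + q₂ z ^ 2))) e := by
    have := dN.fun_mul (dS.fun_inv (by rw [v1, v2]; exact sB))
    simpa only [div_eq_mul_inv] using this
  have acos : HasDerivAt Real.arccos (-(1 / Real.sqrt (1 - L ^ 2))) L :=
    Real.hasDerivAt_arccos l1.ne' l2.ne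
  have vL : (((β₁ e + g / 2 * q₁ e) * (β₂ e + g / 2 * q₂ e) + h ^ 2 * (s e - β₁ e * β₂ e))
        / Real.sqrt ((β₁ e ^ 2 + g * β₁ e * q₁ e + q₁ e ^ 2)
            * (β₂ e ^ 2 + g * β₂ e * q₂ e + q₂ e ^ 2))) = L := by
    rw [v1, v2, vN, hL]
  have dF := (HasDerivAt.comp_hasFDerivAt_of_eq e acos dQ.hasFDerivAt vL.symm).const_mul (1 / h)
  have dF' := cmp _ _ dF.differentiableAt.hasFDerivAt
  have c1 := cmp _ _ hβ₁
  have c2 := cmp _ _ hβ₂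
  have c3 := cmp _ _ hq₁
  have c4 := cmp _ _ hq₂
  have c5 := cmp _ _ hs
  have tN := ((c1.add (c3.const_mul (g / 2))).mul (c2.add (c4.const_mul (g / 2)))).add
    ((c5.sub (c1.mul c2)).const_mul (h ^ 2))
  have tB := (((c1.pow 2).add ((c1.const_mul g).mul c3)).add (c3.pow 2)).mul
    (((c2.pow 2).add ((c2.const_mul g).mul c4)).add (c4.pow 2))
  have tS := tB.sqrt (by simp [v1, v2, p1.ne', p2.ne'])
  have tQ := tN.div tS (by simp [v1, v2, sB])
  have tF := (HasDerivAt.comp_of_eq (0 : ℝ) acos tQ (by simp [v1, v2, vN, hL])).const_mul (1 / h)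
  have key := dF'.unique tF
  refine Eq.trans key ?_
  simp only [Pi.add_apply, Pi.mul_apply, Pi.sub_apply, Pi.pow_apply, e0, eb1, eb2, er1, er2, es,
    ← hB1, ← hB2, ← hN]
  simp only [mul_assoc (1 / h), mul_assoc (-(1 / Real.sqrt (1 - L ^ 2)))]
  refine congrArg (fun T => 1 / h * (-(1 / Real.sqrt (1 - L ^ 2)) * T)) ?_
  clear key tF tQ tS tB tN dF dF' dQ dS dB dN vL c1 c2 c3 c4 c5 hN
  have hsq : Real.sqrt (B1 * B2) ^ 2 = B1 * B2 := Real.sq_sqrt hBB.le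
  generalize Real.sqrt (B1 * B2) = S at *
  rw [hsq]
  field_simp
  simp only [hsq]
  field_simp
  push_cast
  ring

/-- In the flat Finsleroid setting with a unit axis vector field `b`
satisfying the Landsberg condition, the Finsleroid angle
`α(x,y₁,y₂) = (1/h)·arccos Λ(x,y₁,y₂)` satisfies, whenever `q(x,y₁) > 0`,
`q(x,y₂) > 0` and `−1 < Λ(x,y₁,y₂) < 1`, the identity
`D_xα(w) = (1/2)·D_{y₁}α(G_{x,y₁}(w)) + (1/2)·D_{y₂}α(G_{x,y₂}(w))`
(the angle-preservation statement of the Parallel Transportation Theorem). -/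
theorem finsleroid_parallel_transport_angle
    {V : Type*} [NormedAddCommGroup V] [InnerProductSpace ℝ V] [FiniteDimensional ℝ V]
    (U : Set V) (hU : IsOpen U) (b : V → V) (k : V → ℝ)
    (hbs : ContDiffOn ℝ (⊤ : ℕ∞) b U) (hks : ContDiffOn ℝ (⊤ : ℕ∞) k U)
    (hbnorm : ∀ x ∈ U, ‖b x‖ = 1)
    (hDb : ∀ x ∈ U, ∀ u : V, fderiv ℝ b x u = k x • (u - ⟪b x, u⟫_ℝ • b x))
    (g h : ℝ) (hg : |g| < 2) (hh : h = Real.sqrt (1 - g ^ 2 / 4))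
    (q A B : V → V → ℝ) (v : V → V → V) (Lam : V → V → V → ℝ) (G : V → V → V → V)
    (hq : ∀ x y : V, q x y = Real.sqrt (‖y‖ ^ 2 - ⟪b x, y⟫_ℝ ^ 2))
    (hv : ∀ x y : V, v x y = y - ⟪b x, y⟫_ℝ • b x)
    (hA : ∀ x y : V, A x y = ⟪b x, y⟫_ℝ + (g / 2) * q x y)
    (hB : ∀ x y : V, B x y = ⟪b x, y⟫_ℝ ^ 2 + g * ⟪b x, y⟫_ℝ * q x y + q x y ^ 2)
    (hLam : ∀ x y₁ y₂ : V,
      Lam x y₁ y₂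
        = (A x y₁ * A x y₂ + h ^ 2 * (⟪y₁, y₂⟫_ℝ - ⟪b x, y₁⟫_ℝ * ⟪b x, y₂⟫_ℝ))
          / Real.sqrt (B x y₁ * B x y₂))
    (hG : ∀ x y w : V,
      G x y w = (g * k x / q x y)
        • (⟪v x y, w⟫_ℝ • v x y + (q x y ^ 2) • (w - ⟪b x, w⟫_ℝ • b x))) :
    ∀ x ∈ U, ∀ y₁ y₂ : V, 0 < q x y₁ → 0 < q x y₂ →
      -1 < Lam x y₁ y₂ → Lam x y₁ y₂ < 1 → ∀ w : V,
      fderiv ℝ (fun x' => (1 / h) * Real.arccos (Lam x' y₁ y₂)) x w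
        = (1 / 2) * fderiv ℝ (fun y => (1 / h) * Real.arccos (Lam x y y₂)) y₁ (G x y₁ w)
          + (1 / 2)
              * fderiv ℝ (fun y => (1 / h) * Real.arccos (Lam x y₁ y)) y₂ (G x y₂ w) := by
  intro x hx y₁ y₂ hq1 hq2 hl1 hl2 w
  have hg2 : 0 < 1 - g ^ 2 / 4 := by
    have := sq_lt_sq' (abs_lt.mp hg).1 (abs_lt.mp hg).2
    linarith
  have hh2 : h ^ 2 = 1 - g ^ 2 / 4 := by rw [hh, Real.sq_sqrt hg2.le]
  have Bpos : ∀ β r : ℝ, 0 < r → 0 < β ^ 2 + g * β * r + r ^ 2 := by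
    intro β r hr
    have : β ^ 2 + g * β * r + r ^ 2 = (β + g / 2 * r) ^ 2 + (1 - g ^ 2 / 4) * r ^ 2 := by ring
    rw [this]; positivity
  have hb : HasFDerivAt b (fderiv ℝ b x) x :=
    ((hbs.contDiffAt (hU.mem_nhds hx)).differentiableAt (by simp)).hasFDerivAt
  have bb : ⟪b x, b x⟫_ℝ = 1 := by rw [real_inner_self_eq_norm_sq, hbnorm x hx]; norm_num
  have hLam' : ∀ x y₁ y₂ : V, Lam x y₁ y₂ = _ := hLam
  simp only [hA, hB] at hLam'
  have xβ : ∀ y : V, HasFDerivAt (fun z => ⟪b z, y⟫_ℝ) ((innerSL ℝ y).comp (fderiv ℝ b x)) x := by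
    intro y
    have := ((innerSL ℝ y).hasFDerivAt (x := b x)).comp x hb
    refine this.congr_of_eventuallyEq (Filter.Eventually.of_forall fun z => ?_)
    simp [real_inner_comm]
  have xq : ∀ y : V, 0 < q x y → HasFDerivAt (fun z => q z y)
      ((1 / (2 * q x y)) • ((0 : V →L[ℝ] ℝ) - (2 * ⟪b x, y⟫_ℝ) • (innerSL ℝ y).comp (fderiv ℝ b x))) x := by
    intro y hy
    simp only [hq] at hy ⊢
    exact finsl_q (fun z => ⟪b z, y⟫_ℝ) (fun _ => ‖y‖ ^ 2) _ _ x (xβ y) (hasFDerivAt_const _ _) hy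
  have yβ : ∀ y : V, HasFDerivAt (fun z => ⟪b x, z⟫_ℝ) (innerSL ℝ (b x)) y := by
    intro y
    exact (innerSL ℝ (b x)).hasFDerivAt
  have yq : ∀ y : V, 0 < q x y → HasFDerivAt (fun z => q x z)
      ((1 / (2 * q x y)) • (2 • innerSL ℝ y - (2 * ⟪b x, y⟫_ℝ) • innerSL ℝ (b x))) y := by
    intro y hy
    simp only [hq] at hy ⊢
    exact finsl_q (fun z => ⟪b x, z⟫_ℝ) (fun z => ‖z‖ ^ 2) _ _ y (yβ y)
      (hasStrictFDerivAt_norm_sq y).hasFDerivAt hy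
  have ys1 : HasFDerivAt (fun z => ⟪z, y₂⟫_ℝ) (innerSL ℝ y₂) y₁ := by
    refine ((innerSL ℝ y₂).hasFDerivAt (x := y₁)).congr_of_eventuallyEq
      (Filter.Eventually.of_forall fun z => ?_)
    simp [real_inner_comm]
  have ys2 : HasFDerivAt (fun z => ⟪y₁, z⟫_ℝ) (innerSL ℝ y₁) y₂ := (innerSL ℝ y₁).hasFDerivAt
  have P1 := Bpos ⟪b x, y₁⟫_ℝ _ hq1
  have P2 := Bpos ⟪b x, y₂⟫_ℝ _ hq2
  have F1 := finsl_key g h _ _ _ _ (fun _ => ⟪y₁, y₂⟫_ℝ) _ _ _ _ _ x (xβ y₁) (xβ y₂) (xq y₁ hq1) (xq y₂ hq2)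
    (hasFDerivAt_const _ _) _ _ _ _ _ _ _ _ _ rfl rfl rfl rfl rfl rfl rfl P1 P2 rfl
    (hLam' x y₁ y₂) hl1 hl2 w
  have F2 := finsl_key g h _ (fun _ => ⟪b x, y₂⟫_ℝ) _ (fun _ => q x y₂) _ _ _ _ _ _ y₁ (yβ y₁)
    (hasFDerivAt_const _ _) (yq y₁ hq1) (hasFDerivAt_const _ _)
    ys1 _ _ _ _ _ _ _ _ _ rfl rfl rfl rfl rfl rfl rfl P1 P2 rfl
    (hLam' x y₁ y₂) hl1 hl2 (G x y₁ w)
  have F3 := finsl_key g h (fun _ => ⟪b x, y₁⟫_ℝ) _ (fun _ => q x y₁) _ _ _ _ _ _ _ y₂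
    (hasFDerivAt_const _ _) (yβ y₂) (hasFDerivAt_const _ _) (yq y₂ hq2)
    ys2 _ _ _ _ _ _ _ _ _ rfl rfl rfl rfl rfl rfl rfl P1 P2 rfl
    (hLam' x y₁ y₂) hl1 hl2 (G x y₂ w)
  have E1 : (fun x' => (1 / h) * Real.arccos (Lam x' y₁ y₂)) = _ :=
    funext fun x' => by rw [hLam' x' y₁ y₂]
  have E2 : (fun y => (1 / h) * Real.arccos (Lam x y y₂)) = _ :=
    funext fun y => by rw [hLam' x y y₂]
  have E3 : (fun y => (1 / h) * Real.arccos (Lam x y₁ y)) = _ :=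
    funext fun y => by rw [hLam' x y₁ y]
  rw [E1, E2, E3, F1, F2, F3]
  have qs : ∀ y : V, 0 < q x y → ⟪y, y⟫_ℝ = q x y ^ 2 + ⟪b x, y⟫_ℝ ^ 2 := by
    intro y hy
    rw [hq] at hy ⊢
    rw [Real.sq_sqrt (Real.sqrt_pos.mp hy).le, real_inner_self_eq_norm_sq]; ring
  have Q1 := qs y₁ hq1
  have Q2 := qs y₂ hq2
  generalize (1 / h) * (-(1 / Real.sqrt (1 - Lam x y₁ y₂ ^ 2))) * (1 / Real.sqrt _) = K
  rw [mul_left_comm (1 / 2 : ℝ) K, mul_left_comm (1 / 2 : ℝ) K, ← mul_add]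
  refine congrArg (K * ·) ?_
  have c1 : ⟪y₁, b x⟫_ℝ = ⟪b x, y₁⟫_ℝ := real_inner_comm _ _
  have c2 : ⟪y₂, b x⟫_ℝ = ⟪b x, y₂⟫_ℝ := real_inner_comm _ _
  have c3 : ⟪y₂, y₁⟫_ℝ = ⟪y₁, y₂⟫_ℝ := real_inner_comm _ _
  simp only [ContinuousLinearMap.comp_apply, smul_apply,
    sub_apply, zero_apply, innerSL_apply_apply, hDb x hx, hG, hv,
    inner_smul_right, inner_smul_left, inner_sub_right, inner_sub_left, inner_add_right, bb, c1, c2, c3, Q1, Q2,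
    smul_eq_mul, nsmul_eq_mul, RCLike.conj_to_real, hh2]
  generalize ⟪b x, y₁⟫_ℝ = b1 at *
  generalize ⟪b x, y₂⟫_ℝ = b2 at *
  generalize ⟪y₁, y₂⟫_ℝ = s at *
  generalize ⟪y₁, w⟫_ℝ = w1 at *
  generalize ⟪y₂, w⟫_ℝ = w2 at *
  generalize ⟪b x, w⟫_ℝ = bw at *
  generalize q x y₁ = r1 at *
  generalize q x y₂ = r2 at *
  have n1 := hq1.ne'
  have n2 := hq2.ne'
  have m1 := P1.ne'
  have m2 := P2.ne'
  push_cast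
  clear * - n1 n2 m1 m2
  generalize e1 : b1 ^ 2 + g * b1 * r1 + r1 ^ 2 = B1 at *
  generalize e2 : b2 ^ 2 + g * b2 * r2 + r2 ^ 2 = B2 at *
  field_simp
  subst e1 e2
  ring
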